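/- arXiv:1302.1046 — 6 statements merged into one kernel-verified Lean document; each statement's English description precedes it below -/
import Mathlib

section
/- Let T = (T, η, μ) be a monad on the category Set of types and F : Set ⥤ Set an endofunctor that has a T-algebra lifting F*. Assume that a terminal coalgebra exists both for the composite endofunctor X ↦ F(T X) and for F itself. Then for all FT-coalgebras (X, f) and (Y, g) and all x ∈ X, y ∈ Y: if x ∼_{FT} y (x and y are behaviourally equivalent as states of the FT-coalgebras), then x ≈_F^T y (η_X(x) and η_Y(y) are behaviourally equivalent as states of the F-coalgebras (T X, f♯) and (T Y, g♯)). -/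
open CategoryTheory CategoryTheory.Limits

universe u

/-- The carrier of `F*(T.free X)` is `F (T X)`, from the lifting equation. -/
def carrierEq {T : Monad (Type u)} {F : Type u ⥤ Type u}
    {Fstar : Monad.Algebra T ⥤ Monad.Algebra T}
    (hl : Fstar ⋙ T.forget = T.forget ⋙ F) (X : Type u) :
    (Fstar.obj (T.free.obj X)).A = F.obj (T.obj X) :=
  Functor.congr_obj hl (T.free.obj X)

/-- The `T`-algebra structure map `h_X : T (F (T X)) → F (T X)` coming from the lifting. -/
def structMap {T : Monad (Type u)} {F : Type u ⥤ Type u}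
    {Fstar : Monad.Algebra T ⥤ Monad.Algebra T}
    (hl : Fstar ⋙ T.forget = T.forget ⋙ F) (X : Type u) :
    T.obj (F.obj (T.obj X)) ⟶ F.obj (T.obj X) :=
  eqToHom (congrArg T.obj (carrierEq hl X).symm) ≫ (Fstar.obj (T.free.obj X)).a ≫
    eqToHom (carrierEq hl X)

/-- `f♯ = h_X ∘ T f : T X → F (T X)`. -/
def fSharp {T : Monad (Type u)} {F : Type u ⥤ Type u}
    {Fstar : Monad.Algebra T ⥤ Monad.Algebra T}
    (hl : Fstar ⋙ T.forget = T.forget ⋙ F) {X : Type u}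
    (f : X ⟶ F.obj (T.obj X)) : T.obj X ⟶ F.obj (T.obj X) :=
  T.map f ≫ structMap hl X

theorem structMap_naturality {T : Monad (Type u)} {F : Type u ⥤ Type u}
    {Fstar : Monad.Algebra T ⥤ Monad.Algebra T}
    (hl : Fstar ⋙ T.forget = T.forget ⋙ F) {X Z : Type u} (k : X ⟶ Z) :
    T.map (F.map (T.map k)) ≫ structMap hl Z = structMap hl X ≫ F.map (T.map k) := by
  have e : F.map (T.map k) = eqToHom (carrierEq hl X).symm ≫
      (Fstar.map (T.free.map k)).f ≫ eqToHom (carrierEq hl Z) := by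
    have := Functor.congr_hom hl.symm (T.free.map k)
    exact this
  have h := (Fstar.map (T.free.map k)).h
  rw [e]
  simp only [structMap, Functor.map_comp, eqToHom_map, Category.assoc, eqToHom_trans_assoc,
    eqToHom_refl, Category.id_comp]
  rw [reassoc_of% h]

/-- Applying `T` to a morphism of `FT`-coalgebras yields a morphism between the `F`-coalgebras
obtained by determinization. -/
def fSharpHom {T : Monad (Type u)} {F : Type u ⥤ Type u}
    {Fstar : Monad.Algebra T ⥤ Monad.Algebra T}
    (hl : Fstar ⋙ T.forget = T.forget ⋙ F)
    {C D : Endofunctor.Coalgebra (T.toFunctor ⋙ F)} (k : C ⟶ D) :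
    (⟨T.obj C.V, fSharp hl C.str⟩ : Endofunctor.Coalgebra F) ⟶ ⟨T.obj D.V, fSharp hl D.str⟩ where
  f := T.map k.f
  h := by
    have h : C.str ≫ F.map (T.map k.f) = k.f ≫ D.str := k.h
    simp only [fSharp, Category.assoc]
    rw [← structMap_naturality, ← Functor.map_comp_assoc, h, Functor.map_comp_assoc]

/-- The unique map from the determinization of `C` to the terminal `F`-coalgebra, at `η x`, depends
only on the image of `x` under a morphism of `FT`-coalgebras out of `C`. -/
theorem terminal_from_fSharp_eta {T : Monad (Type u)} {F : Type u ⥤ Type u}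
    {Fstar : Monad.Algebra T ⥤ Monad.Algebra T}
    (hl : Fstar ⋙ T.forget = T.forget ⋙ F) [HasTerminal (Endofunctor.Coalgebra F)]
    {C D : Endofunctor.Coalgebra (T.toFunctor ⋙ F)} (k : C ⟶ D) (x : C.V) :
    (terminal.from (⟨T.obj C.V, fSharp hl C.str⟩ : Endofunctor.Coalgebra F)).f (T.η.app C.V x)
      = (terminal.from (⟨T.obj D.V, fSharp hl D.str⟩ : Endofunctor.Coalgebra F)).f
          (T.η.app D.V (k.f x)) := by
  rw [← terminal.comp_from (fSharpHom hl k)]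
  exact congrArg _ (ConcreteCategory.congr_hom (T.η.naturality k.f) x).symm

/-- behavioural equivalence `∼_{FT}` implies `≈_F^T`. -/
theorem bisim_implies_trace
    (T : Monad (Type u)) (F : Type u ⥤ Type u)
    (Fstar : Monad.Algebra T ⥤ Monad.Algebra T)
    (hl : Fstar ⋙ T.forget = T.forget ⋙ F)
    [HasTerminal (Endofunctor.Coalgebra (T.toFunctor ⋙ F))]
    [HasTerminal (Endofunctor.Coalgebra F)]
    (X Y : Type u) (f : X ⟶ F.obj (T.obj X)) (g : Y ⟶ F.obj (T.obj Y))
    (x : X) (y : Y)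
    (hxy : (terminal.from (⟨X, f⟩ : Endofunctor.Coalgebra (T.toFunctor ⋙ F))).f x
         = (terminal.from (⟨Y, g⟩ : Endofunctor.Coalgebra (T.toFunctor ⋙ F))).f y) :
    (terminal.from (⟨T.obj X, fSharp hl f⟩ : Endofunctor.Coalgebra F)).f (T.η.app X x)
      = (terminal.from (⟨T.obj Y, fSharp hl g⟩ : Endofunctor.Coalgebra F)).f (T.η.app Y y) := by
  exact (terminal_from_fSharp_eta hl
      (terminal.from (⟨X, f⟩ : Endofunctor.Coalgebra (T.toFunctor ⋙ F))) x).trans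
    ((congrArg _ (congrArg _ hxy)).trans
      (terminal_from_fSharp_eta hl
        (terminal.from (⟨Y, g⟩ : Endofunctor.Coalgebra (T.toFunctor ⋙ F))) y).symm)
end

section
/- Let T = (T, η, μ) be a monad on Set and F : Set ⥤ Set an endofunctor. Then F has a T-algebra lifting if and only if there exists a distributive law of T over F, i.e. a natural transformation λ with components λ_X : T(F(X)) → F(T(X)) satisfying λ_X ∘ η_{F(X)} = F(η_X) and λ_X ∘ μ_{F(X)} = F(μ_X) ∘ λ_{T(X)} ∘ T(λ_X) for every X. -/
open CategoryTheory

universe u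

namespace CategoryTheory.Monad

variable {C : Type*} [Category C] {T : Monad C} {F : C ⥤ C}

/-- The lifting of `F` to `T`-algebras induced by a distributive law: an algebra `a : T A ⟶ A` is
sent to `λ_A ≫ F a : T (F A) ⟶ F A`. -/
def liftOfDistributiveLaw (lam : F ⋙ T.toFunctor ⟶ T.toFunctor ⋙ F)
    (hη : ∀ X, T.η.app (F.obj X) ≫ lam.app X = F.map (T.η.app X))
    (hμ : ∀ X, T.μ.app (F.obj X) ≫ lam.app X
      = T.map (lam.app X) ≫ lam.app (T.obj X) ≫ F.map (T.μ.app X)) :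
    Algebra T ⥤ Algebra T where
  obj A :=
    { A := F.obj A.A
      a := lam.app A.A ≫ F.map A.a
      unit := by
        rw [reassoc_of% (hη A.A), ← F.map_comp, A.unit, F.map_id]
      assoc := by
        have h : T.map (F.map A.a) ≫ lam.app A.A = lam.app (T.obj A.A) ≫ F.map (T.map A.a) :=
          lam.naturality A.a
        rw [reassoc_of% (hμ A.A), ← F.map_comp, A.assoc, F.map_comp, T.map_comp, Category.assoc,
          reassoc_of% h] }
  map {A B} f :=
    { f := F.map f.f
      h := by
        have h : T.map (F.map f.f) ≫ lam.app B.A = lam.app A.A ≫ F.map (T.map f.f) :=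
          lam.naturality f.f
        change T.map (F.map f.f) ≫ lam.app B.A ≫ F.map B.a = (lam.app A.A ≫ F.map A.a) ≫ F.map f.f
        rw [reassoc_of% h, ← F.map_comp, f.h, F.map_comp, Category.assoc] }
  map_id A := by ext; exact F.map_id _
  map_comp f g := by ext; exact F.map_comp _ _

section

variable {G : Algebra T ⥤ Algebra T} (e : ∀ A, (G.obj A).A ≅ F.obj A.A)

/-- The structure map on `F A` transported from the algebra `G A`. -/
def liftStr (A : Algebra T) : T.obj (F.obj A.A) ⟶ F.obj A.A :=
  T.map (e A).inv ≫ (G.obj A).a ≫ (e A).hom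

lemma unit_liftStr (A : Algebra T) : T.η.app (F.obj A.A) ≫ liftStr e A = 𝟙 (F.obj A.A) := by
  have h : (e A).inv ≫ T.η.app (G.obj A).A = T.η.app (F.obj A.A) ≫ T.map (e A).inv :=
    T.η.naturality (e A).inv
  rw [liftStr, ← reassoc_of% h, Algebra.unit_assoc, Iso.inv_hom_id]

lemma assoc_liftStr (A : Algebra T) :
    T.μ.app (F.obj A.A) ≫ liftStr e A = T.map (liftStr e A) ≫ liftStr e A := by
  have h : T.map (T.map (e A).inv) ≫ T.μ.app (G.obj A).A
      = T.μ.app (F.obj A.A) ≫ T.map (e A).inv := T.μ.naturality (e A).inv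
  simp only [liftStr, T.map_comp, Category.assoc]
  rw [← reassoc_of% h, Algebra.assoc_assoc, ← T.map_comp_assoc (e A).hom, Iso.hom_inv_id,
    T.map_id, Category.id_comp]

lemma map_liftStr
    (he : ∀ {A B : Algebra T} (f : A ⟶ B), (G.map f).f ≫ (e B).hom = (e A).hom ≫ F.map f.f)
    {A B : Algebra T} (f : A ⟶ B) :
    T.map (F.map f.f) ≫ liftStr e B = liftStr e A ≫ F.map f.f := by
  have hi : F.map f.f ≫ (e B).inv = (e A).inv ≫ (G.map f).f := by
    rw [Iso.comp_inv_eq, Category.assoc, he, Iso.inv_hom_id_assoc]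
  simp only [liftStr, Category.assoc]
  rw [← T.map_comp_assoc, hi, T.map_comp_assoc, Algebra.Hom.h_assoc, he]

/-- The structure map on `F (T X)` transported from the lifted free algebra on `X`. -/
def freeLiftStr (X : C) : T.obj (F.obj (T.obj X)) ⟶ F.obj (T.obj X) :=
  liftStr e (T.free.obj X)

variable (he : ∀ {A B : Algebra T} (f : A ⟶ B),
  (G.map f).f ≫ (e B).hom = (e A).hom ≫ F.map f.f)

/-- The distributive law induced by a lifting of `F` to `T`-algebras. -/
def distributiveLawOfLift : F ⋙ T.toFunctor ⟶ T.toFunctor ⋙ F where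
  app X := T.map (F.map (T.η.app X)) ≫ freeLiftStr e X
  naturality X Y f := by
    have h : f ≫ T.η.app Y = T.η.app X ≫ T.map f := T.η.naturality f
    have h' : T.map (F.map (T.map f)) ≫ freeLiftStr e Y = freeLiftStr e X ≫ F.map (T.map f) :=
      map_liftStr e he (T.free.map f)
    change T.map (F.map f) ≫ T.map (F.map (T.η.app Y)) ≫ freeLiftStr e Y
      = (T.map (F.map (T.η.app X)) ≫ freeLiftStr e X) ≫ F.map (T.map f)
    rw [← T.map_comp_assoc, ← F.map_comp, h, F.map_comp, T.map_comp_assoc, h', Category.assoc]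

lemma distributiveLawOfLift_app (X : C) :
    (distributiveLawOfLift e he).app X = T.map (F.map (T.η.app X)) ≫ freeLiftStr e X :=
  rfl

lemma unit_distributiveLawOfLift (X : C) :
    T.η.app (F.obj X) ≫ (distributiveLawOfLift e he).app X = F.map (T.η.app X) := by
  have h : F.map (T.η.app X) ≫ T.η.app (F.obj (T.obj X))
      = T.η.app (F.obj X) ≫ T.map (F.map (T.η.app X)) := T.η.naturality _
  have hu : T.η.app (F.obj (T.obj X)) ≫ freeLiftStr e X = 𝟙 (F.obj (T.obj X)) :=
    unit_liftStr e (T.free.obj X)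
  rw [distributiveLawOfLift_app, ← reassoc_of% h, hu, Category.comp_id]

lemma mul_distributiveLawOfLift (X : C) :
    T.μ.app (F.obj X) ≫ (distributiveLawOfLift e he).app X
      = T.map ((distributiveLawOfLift e he).app X) ≫
        (distributiveLawOfLift e he).app (T.obj X) ≫ F.map (T.μ.app X) := by
  have h : T.map (T.map (F.map (T.η.app X))) ≫ T.μ.app (F.obj (T.obj X))
      = T.μ.app (F.obj X) ≫ T.map (F.map (T.η.app X)) := T.μ.naturality _
  have ha : T.μ.app (F.obj (T.obj X)) ≫ freeLiftStr e X
      = T.map (freeLiftStr e X) ≫ freeLiftStr e X := assoc_liftStr e (T.free.obj X)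
  let m : T.free.obj (T.obj X) ⟶ T.free.obj X := { f := T.μ.app X, h := T.assoc X }
  have hm : T.map (F.map (T.μ.app X)) ≫ freeLiftStr e X
      = freeLiftStr e (T.obj X) ≫ F.map (T.μ.app X) := map_liftStr e he m
  have hr : (distributiveLawOfLift e he).app (T.obj X) ≫ F.map (T.μ.app X)
      = freeLiftStr e X := by
    rw [distributiveLawOfLift_app, Category.assoc, ← hm, ← T.map_comp_assoc, ← F.map_comp,
      T.left_unit, F.map_id, T.map_id, Category.id_comp]
  rw [hr, distributiveLawOfLift_app, ← reassoc_of% h, ha, T.map_comp, Category.assoc]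

end

end CategoryTheory.Monad

/-- an endofunctor `F` on `Type u` has a `T`-algebra lifting if and only if
there is a distributive law `λ : T F ⟹ F T` of the monad `T` over `F`, i.e. a natural
transformation with components `λ_X : T (F X) → F (T X)` compatible with the unit and the
multiplication of `T`. -/
theorem lifting_iff_distributive_law (T : Monad (Type u)) (F : Type u ⥤ Type u) :
    (∃ Fstar : Monad.Algebra T ⥤ Monad.Algebra T,
        Fstar ⋙ T.forget = T.forget ⋙ F) ↔
    ∃ lam : F ⋙ T.toFunctor ⟶ T.toFunctor ⋙ F,
      (∀ X : Type u, T.η.app (F.obj X) ≫ lam.app X = F.map (T.η.app X)) ∧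
      (∀ X : Type u, T.μ.app (F.obj X) ≫ lam.app X
          = T.map (lam.app X) ≫ lam.app (T.obj X) ≫ F.map (T.μ.app X)) := by
  constructor
  · rintro ⟨G, hG⟩
    let e (A : T.Algebra) : (G.obj A).A ≅ F.obj A.A := (eqToIso hG).app A
    have he {A B : T.Algebra} (f : A ⟶ B) : (G.map f).f ≫ (e B).hom = (e A).hom ≫ F.map f.f :=
      (eqToIso hG).hom.naturality f
    exact ⟨Monad.distributiveLawOfLift e he, Monad.unit_distributiveLawOfLift e he,
      Monad.mul_distributiveLawOfLift e he⟩
  · rintro ⟨lam, hη, hμ⟩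
    exact ⟨Monad.liftOfDistributiveLaw lam hη hμ, rfl⟩
end

section
/- Let g be a context-free grammar (terminal alphabet T, nonterminal alphabet N) in Greibach normal form, i.e. every production rule has the form n → a·α where a is a terminal and α ∈ List N is a (possibly empty) word of nonterminals. Define a stack machine on List N whose steps read one terminal: the stack n :: β can step to α ++ β reading a whenever n → a·α is a rule of g; extend to words by [β →_[] β] and [β →_{a::w} β'' iff β →_a β' and β' →_w β'']. Then for every nonterminal n and every word w ∈ List T: g derives the terminal word w from the single nonterminal n (g.Derives [Symbol.nonterminal n] (w.map Symbol.terminal)) if and only if the stack [n] can reach the empty stack [] reading w. -/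
namespace Stmt12

variable {T : Type}

/-- One step of the stack machine associated to a grammar in Greibach normal form:
the stack `n :: β` can step to `α ++ β` reading the terminal `a` whenever `n → a·α`
is a rule of `g`. -/
def StackStep (g : ContextFreeGrammar T) (β : List g.NT) (a : T) (β' : List g.NT) : Prop :=
  ∃ (n : g.NT) (γ α : List g.NT),
    β = n :: γ ∧ β' = α ++ γ ∧
    ∃ r ∈ g.rules, r.input = n ∧
      r.output = Symbol.terminal a :: α.map Symbol.nonterminal

/-- Reading a word with the stack machine. -/
inductive StackReach (g : ContextFreeGrammar T) : List g.NT → List T → List g.NT → Prop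
  | nil (β) : StackReach g β [] β
  | cons {β β' β'' a w} : StackStep g β a β' → StackReach g β' w β'' →
      StackReach g β (a :: w) β''

/-- Reading a word by leftmost derivation from a sentential form: a leading terminal is read off,
a leading nonterminal `n` is replaced by `α` reading `a` whenever `n → a·α` is a rule of `g`. -/
inductive FormReads (g : ContextFreeGrammar T) : List (Symbol T g.NT) → List T → Prop
  | nil : FormReads g [] []
  | terminal {a s w} : FormReads g s w → FormReads g (Symbol.terminal a :: s) (a :: w)
  | rule {r a s w} {α : List g.NT} : r ∈ g.rules →
      r.output = Symbol.terminal a :: α.map Symbol.nonterminal →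
      FormReads g (α.map Symbol.nonterminal ++ s) w →
      FormReads g (Symbol.nonterminal r.input :: s) (a :: w)

theorem FormReads.map_terminal (g : ContextFreeGrammar T) (w : List T) :
    FormReads g (w.map Symbol.terminal) w := by
  induction w with
  | nil => exact .nil
  | cons a w ih => exact .terminal ih

theorem FormReads.of_head {g : ContextFreeGrammar T} {r : ContextFreeRule T g.NT}
    (hr : r ∈ g.rules)
    (hgr : ∃ (a : T) (α : List g.NT), r.output = Symbol.terminal a :: α.map Symbol.nonterminal)
    {s : List (Symbol T g.NT)} {w : List T} (h : FormReads g (r.output ++ s) w) :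
    FormReads g (Symbol.nonterminal r.input :: s) w := by
  obtain ⟨a, α, ho⟩ := hgr
  rw [ho, List.cons_append] at h
  cases h with
  | terminal h => exact .rule hr ho h

theorem FormReads.of_rewrites {g : ContextFreeGrammar T} {r : ContextFreeRule T g.NT}
    (hr : r ∈ g.rules)
    (hgr : ∃ (a : T) (α : List g.NT), r.output = Symbol.terminal a :: α.map Symbol.nonterminal)
    {u v : List (Symbol T g.NT)} {w : List T} (h : FormReads g v w) (huv : r.Rewrites u v) :
    FormReads g u w := by
  induction h generalizing u with
  | nil =>
    generalize hv : ([] : List (Symbol T g.NT)) = v at huv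
    cases huv with
    | head s => exact .of_head hr hgr (hv ▸ .nil)
    | cons x h => cases hv
  | @terminal a s w h ih =>
    generalize hv : Symbol.terminal a :: s = v at huv
    cases huv with
    | head s => exact .of_head hr hgr (hv ▸ .terminal h)
    | cons x h' => cases hv; exact .terminal (ih h')
  | @rule r' a s w α hr' ho h ih =>
    generalize hv : Symbol.nonterminal r'.input :: s = v at huv
    cases huv with
    | head s => exact .of_head hr hgr (hv ▸ .rule hr' ho h)
    | cons x h' => cases hv; exact .rule hr' ho (ih (h'.append_left _))

theorem FormReads.of_derives {g : ContextFreeGrammar T}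
    (greibach : ∀ r ∈ g.rules, ∃ (a : T) (α : List g.NT),
        r.output = Symbol.terminal a :: α.map Symbol.nonterminal)
    {u : List (Symbol T g.NT)} {w : List T} (h : g.Derives u (w.map Symbol.terminal)) :
    FormReads g u w := by
  induction h using Relation.ReflTransGen.head_induction_on with
  | refl => exact .map_terminal g w
  | head huv _ ih =>
    obtain ⟨r, hr, hrw⟩ := huv
    exact ih.of_rewrites hr (greibach r hr) hrw

theorem FormReads.stackReach {g : ContextFreeGrammar T} {β : List g.NT} {w : List T}
    (h : FormReads g (β.map Symbol.nonterminal) w) : StackReach g β w [] := by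
  generalize hs : β.map Symbol.nonterminal = s at h
  induction h generalizing β with
  | nil =>
    obtain rfl := List.map_eq_nil_iff.mp hs
    exact .nil _
  | terminal _ _ => cases β <;> simp at hs
  | @rule r a s w α hr ho _ ih =>
    cases β with
    | nil => simp at hs
    | cons n γ =>
      simp only [List.map_cons, List.cons.injEq, Symbol.nonterminal.injEq] at hs
      obtain ⟨hn, rfl⟩ := hs
      exact .cons ⟨n, γ, α, rfl, rfl, r, hr, hn.symm, ho⟩ (ih List.map_append)

theorem StackStep.produces {g : ContextFreeGrammar T} {β β' : List g.NT} {a : T}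
    (h : StackStep g β a β') :
    g.Produces (β.map Symbol.nonterminal) (Symbol.terminal a :: β'.map Symbol.nonterminal) := by
  obtain ⟨n, γ, α, rfl, rfl, r, hr, rfl, ho⟩ := h
  refine ⟨r, hr, ?_⟩
  simpa [ho] using ContextFreeRule.Rewrites.head (r := r) (γ.map Symbol.nonterminal)

theorem StackReach.derives {g : ContextFreeGrammar T} {β β' : List g.NT} {w : List T}
    (h : StackReach g β w β') :
    g.Derives (β.map Symbol.nonterminal)
      (w.map Symbol.terminal ++ β'.map Symbol.nonterminal) := by
  induction h with
  | nil β => exact .refl _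
  | cons hstep _ ih => exact hstep.produces.trans_derives (ih.append_left [_])

/-- for a context-free grammar `g` in Greibach normal form, a terminal word
`w` is derivable from a nonterminal `n` iff the associated stack machine can go from the
stack `[n]` to the empty stack reading `w`. -/
theorem greibach_derives_iff_stack (g : ContextFreeGrammar T)
    (greibach : ∀ r ∈ g.rules, ∃ (a : T) (α : List g.NT),
        r.output = Symbol.terminal a :: α.map Symbol.nonterminal) :
    ∀ (n : g.NT) (w : List T),
      g.Derives [Symbol.nonterminal n] (w.map Symbol.terminal) ↔
        StackReach g [n] w [] := by
  intro n w
  refine ⟨fun h => FormReads.stackReach (β := [n]) (.of_derives greibach h), fun h => ?_⟩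
  simpa using h.derives

end Stmt12
end

section
/- Failure semantics via the generalized powerset construction: let (X, δ : X → A → Finset X) be a finitely branching labelled transition system. Define fl : Finset X → List A → Set (Set A) by fl(Y, []) = ⋃_{y ∈ Y} {Z ⊆ A | Z ∩ I(y) = ∅} and fl(Y, a :: w) = fl(Y.biUnion (fun y => δ y a), w). Then for every state x ∈ X, word w ∈ List A and set of labels Z ⊆ A: Z ∈ fl({x}, w) if and only if ⟨w, Z⟩ is a failure pair of x, i.e. there exists y with x →_w y and Z ∩ I(y) = ∅. -/
namespace Stmt15

variable {X A : Type}

/-- Reading a word in a finitely branching LTS. -/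
inductive Reach (δ : X → A → Finset X) : X → List A → X → Prop
  | nil (x) : Reach δ x [] x
  | cons {x y z a w} : y ∈ δ x a → Reach δ y w z → Reach δ x (a :: w) z

/-- The set `I(y)` of labels enabled at a state `y`. -/
def enabled (δ : X → A → Finset X) (y : X) : Set A := {a | δ y a ≠ ∅}

/-- The determinized failure map `fl : Finset X → List A → Set (Set A)` of the
generalized powerset construction. -/
def fl [DecidableEq X] (δ : X → A → Finset X) : Finset X → List A → Set (Set A)
  | Y, [] => ⋃ y ∈ Y, {Z | Z ∩ enabled δ y = ∅}
  | Y, a :: w => fl δ (Y.biUnion fun y => δ y a) w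

theorem reach_nil_iff (δ : X → A → Finset X) {x z : X} : Reach δ x [] z ↔ x = z :=
  ⟨fun h => by cases h; rfl, fun h => h ▸ .nil x⟩

theorem reach_cons_iff (δ : X → A → Finset X) {x z : X} {a : A} {w : List A} :
    Reach δ x (a :: w) z ↔ ∃ y ∈ δ x a, Reach δ y w z := by
  constructor
  · rintro (_ | ⟨hy, h⟩)
    exact ⟨_, hy, h⟩
  · rintro ⟨y, hy, h⟩
    exact .cons hy h

theorem mem_fl_iff [DecidableEq X] (δ : X → A → Finset X) (Y : Finset X) (w : List A)
    (Z : Set A) :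
    Z ∈ fl δ Y w ↔ ∃ x ∈ Y, ∃ y, Reach δ x w y ∧ Z ∩ enabled δ y = ∅ := by
  induction w generalizing Y with
  | nil => simp [fl, reach_nil_iff]
  | cons a w ih =>
    simp only [fl, ih, reach_cons_iff, Finset.mem_biUnion]
    constructor
    · rintro ⟨y, ⟨x, hx, hy⟩, z, h, hZ⟩
      exact ⟨x, hx, z, ⟨y, hy, h⟩, hZ⟩
    · rintro ⟨x, hx, z, ⟨y, hy, h⟩, hZ⟩
      exact ⟨y, ⟨x, hx, hy⟩, z, h, hZ⟩

/-- `Z ∈ fl {x} w` iff `⟨w, Z⟩` is a failure pair of `x`,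
i.e. `x →_w y` for some `y` with `Z ∩ I(y) = ∅`. -/
theorem failure_semantics [DecidableEq X] (δ : X → A → Finset X)
    (x : X) (w : List A) (Z : Set A) :
    Z ∈ fl δ {x} w ↔ ∃ y, Reach δ x w y ∧ Z ∩ enabled δ y = ∅ := by
  simp [mem_fl_iff]

end Stmt15
end

section
/- Ready semantics via the generalized powerset construction: let (X, δ : X → A → Finset X) be a finitely branching labelled transition system. Define rd : Finset X → List A → Set (Set A) by rd(Y, []) = {I(y) | y ∈ Y} and rd(Y, a :: w) = rd(Y.biUnion (fun y => δ y a), w). Then for every state x ∈ X, word w ∈ List A and set of labels Z ⊆ A: Z ∈ rd({x}, w) if and only if ⟨w, Z⟩ is a ready pair of x, i.e. there exists y with x →_w y and Z = I(y). -/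
namespace Stmt16

variable {X A : Type}

/-- Reading a word in a finitely branching LTS. -/
inductive Reach (δ : X → A → Finset X) : X → List A → X → Prop
  | nil (x) : Reach δ x [] x
  | cons {x y z a w} : y ∈ δ x a → Reach δ y w z → Reach δ x (a :: w) z

/-- The set `I(y)` of labels enabled at a state `y`. -/
def enabled (δ : X → A → Finset X) (y : X) : Set A := {a | δ y a ≠ ∅}

/-- The determinized ready map `rd : Finset X → List A → Set (Set A)` of the
generalized powerset construction. -/
def rd [DecidableEq X] (δ : X → A → Finset X) : Finset X → List A → Set (Set A)
  | Y, [] => {Z | ∃ y ∈ Y, Z = enabled δ y}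
  | Y, a :: w => rd δ (Y.biUnion fun y => δ y a) w

/-- The ready map at a set of states collects the ready pairs of all its elements. -/
theorem mem_rd_iff [DecidableEq X] (δ : X → A → Finset X) (Y : Finset X) (w : List A)
    (Z : Set A) :
    Z ∈ rd δ Y w ↔ ∃ x ∈ Y, ∃ y, Reach δ x w y ∧ Z = enabled δ y := by
  induction w generalizing Y with
  | nil =>
    constructor
    · rintro ⟨y, hy, hZ⟩
      exact ⟨y, hy, y, .nil y, hZ⟩
    · rintro ⟨x, hx, y, hxy, hZ⟩
      cases hxy
      exact ⟨x, hx, hZ⟩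
  | cons a w ih =>
    rw [rd, ih]
    constructor
    · rintro ⟨y, hy, z, hyz, hZ⟩
      obtain ⟨x, hx, hxy⟩ := Finset.mem_biUnion.mp hy
      exact ⟨x, hx, z, .cons hxy hyz, hZ⟩
    · rintro ⟨x, hx, z, hxz, hZ⟩
      cases hxz with
      | cons hxy hyz => exact ⟨_, Finset.mem_biUnion.mpr ⟨x, hx, hxy⟩, z, hyz, hZ⟩

/-- `Z ∈ rd {x} w` iff `⟨w, Z⟩` is a ready pair of `x`,
i.e. `x →_w y` for some `y` with `Z = I(y)`. -/
theorem ready_semantics [DecidableEq X] (δ : X → A → Finset X)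
    (x : X) (w : List A) (Z : Set A) :
    Z ∈ rd δ {x} w ↔ ∃ y, Reach δ x w y ∧ Z = enabled δ y := by
  simp [mem_rd_iff]

end Stmt16
end

section
/- Let A be a nonempty type and B any type. Call f : Stream' A → Stream' B causal if for all n and all streams σ, τ that agree on their first n + 1 entries, (f σ) n = (f τ) n. The set Γ of causal functions carries a coalgebra structure for the endofunctor X ↦ A → (B × X) on Type: given causal f and a ∈ A, output the value (f (a ::ₛ σ)) 0 (which by causality is independent of the choice of σ) together with the derivative f_a defined by f_a(σ) := tail (f (a ::ₛ σ)) (which is again causal). This coalgebra (Γ, f ↦ fun a => ((f (a ::ₛ σ₀)) 0, f_a)) is a terminal coalgebra of the endofunctor X ↦ A → (B × X): every coalgebra t : X → A → (B × X) admits a unique coalgebra homomorphism into it. -/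
namespace Stmt19

/-- `f` is causal if the `n`-th output entry depends only on the first `n + 1` input
entries. -/
def Causal {A B : Type} (f : Stream' A → Stream' B) : Prop :=
  ∀ (n : ℕ) (σ τ : Stream' A), (∀ i ≤ n, σ.get i = τ.get i) → (f σ).get n = (f τ).get n

/-- The set of causal functions from `Stream' A` to `Stream' B`. -/
def Gamma (A B : Type) : Type := {f : Stream' A → Stream' B // Causal f}

/-- The input derivative `f_a (σ) = tail (f (a :: σ))` of a stream function. -/
def deriv {A B : Type} (f : Stream' A → Stream' B) (a : A) : Stream' A → Stream' B :=
  fun σ => (f (Stream'.cons a σ)).tail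

/-- Derivatives of causal functions are causal. -/
theorem causal_deriv {A B : Type} {f : Stream' A → Stream' B} (hf : Causal f) (a : A) :
    Causal (deriv f a) := by
  intro n σ τ h
  have hc : ∀ i ≤ n + 1, (Stream'.cons a σ).get i = (Stream'.cons a τ).get i := by
    intro i hi
    cases i with
    | zero => rfl
    | succ j =>
        simpa [Stream'.get_succ_cons] using h j (Nat.le_of_succ_le_succ hi)
  simpa [deriv, Stream'.get_tail] using hf (n + 1) _ _ hc

/-- The Mealy coalgebra structure on causal functions: output the first entry of
`f (a :: σ₀)` (independent of `σ₀` by causality) together with the derivative `f_a`. -/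
noncomputable def mealyStr (A B : Type) [Nonempty A] : Gamma A B → A → B × Gamma A B :=
  fun f a =>
    ((f.1 (Stream'.cons a (Stream'.const (Classical.arbitrary A)))).get 0,
      ⟨deriv f.1 a, causal_deriv f.2 a⟩)

/-- The `n`-th output of the Mealy machine `t` started in state `x` on the input stream `σ`. -/
def mealyOutput {A B X : Type} (t : X → A → B × X) : ℕ → X → Stream' A → B
  | 0, x, σ => (t x σ.head).1
  | n + 1, x, σ => mealyOutput t n (t x σ.head).2 σ.tail

theorem causal_mealyOutput {A B X : Type} (t : X → A → B × X) (x : X) :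
    Causal fun σ n => mealyOutput t n x σ := by
  intro n
  change ∀ σ τ : Stream' A, _ → mealyOutput t n x σ = mealyOutput t n x τ
  induction n generalizing x with
  | zero =>
      intro σ τ h
      have h0 : σ.head = τ.head := h 0 le_rfl
      simp only [mealyOutput, h0]
  | succ n ih =>
      intro σ τ h
      have h0 : σ.head = τ.head := h 0 (Nat.zero_le _)
      simp only [mealyOutput, h0]
      exact ih _ _ _ fun i hi => h (i + 1) (Nat.succ_le_succ hi)

/-- A coalgebra homomorphism into the causal functions computes the outputs of the machine. -/
theorem get_eq_mealyOutput {A B X : Type} [Nonempty A] {t : X → A → B × X} {h : X → Gamma A B}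
    (hh : ∀ (x : X) (a : A), mealyStr A B (h x) a = ((t x a).1, h (t x a).2))
    (n : ℕ) (x : X) (σ : Stream' A) : ((h x).1 σ).get n = mealyOutput t n x σ := by
  induction n generalizing x σ with
  | zero =>
      refine Eq.trans ?_ (congrArg (fun p => p.1) (hh x σ.head))
      refine (h x).2 0 _ _ fun i hi => ?_
      obtain rfl := Nat.le_zero.mp hi
      rfl
  | succ n ih =>
      have hd : deriv (h x).1 σ.head = (h (t x σ.head).2).1 :=
        congrArg (fun p => p.2.1) (hh x σ.head)
      rw [mealyOutput, ← ih, ← hd, deriv, Stream'.get_tail, Stream'.eta]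

/-- the coalgebra of causal functions is a terminal coalgebra for the Mealy
endofunctor `X ↦ A → (B × X)`: every coalgebra `t : X → A → B × X` admits a unique
coalgebra homomorphism into `(Γ, mealyStr)`. -/
theorem causal_functions_terminal (A B : Type) [Nonempty A]
    (X : Type) (t : X → A → B × X) :
    ∃! h : X → Gamma A B,
      ∀ (x : X) (a : A), mealyStr A B (h x) a = ((t x a).1, h (t x a).2) := by
  refine ⟨fun x => ⟨fun σ n => mealyOutput t n x σ, causal_mealyOutput t x⟩,
    fun x a => rfl, fun h hh => ?_⟩
  funext x
  refine Subtype.ext (funext fun σ => Stream'.ext fun n => ?_)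
  exact get_eq_mealyOutput hh n x σ

end Stmt19
end
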